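/- Let n ≥ 1, 1 < p < ∞, 0 < r < p, and 0 < α < 1. Let 𝒮 be an η-sparse collection of dyadic cubes in ℝⁿ and let ω, σ be weights on ℝⁿ with [ω]_{A∞} < ∞, [σ]_{A∞} < ∞ and [ω,σ]_{A^α_{pp}(𝒮)} < ∞. Then there is a constant C depending only on n, p, r, α, η such that for all f ∈ L^p_σ: ‖A^{r,α}_𝒮(fσ)‖_{L^p_ω} ≤ C · [ω,σ]_{A^α_{pp}(𝒮)} · ( [ω]_{A∞}^{(1/r)(1−r/p)²} [σ]_{A∞}^{(1/r)(1−(1−r/p)²)} + [ω]_{A∞}^{(1/r)(1−(r/p)²)} [σ]_{A∞}^{(1/r)(r/p)²} ) · ‖f‖_{L^p_σ}. (Main theorem, exceptional diagonal case p = q > r with α < 1.) -/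

import Mathlib

open MeasureTheory ENNReal Set

noncomputable section

/-- An axis-parallel (closed) cube in ℝⁿ with corner `corner` and side length `side > 0`. -/
structure Cube (n : ℕ) where
  corner : Fin n → ℝ
  side : ℝ
  side_pos : 0 < side

namespace Cube

/-- The set of points of the cube. -/
def carrier {n : ℕ} (Q : Cube n) : Set (Fin n → ℝ) :=
  {x | ∀ i, Q.corner i ≤ x i ∧ x i ≤ Q.corner i + Q.side}

/-- The volume `|Q|` of the cube. -/
def vol {n : ℕ} (Q : Cube n) : ℝ := Q.side ^ n

/-- `Q` is a cube of the standard dyadic grid: `Q = 2^{-j}([0,1]^n + m)`. -/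
def IsDyadic {n : ℕ} (Q : Cube n) : Prop :=
  ∃ (j : ℤ) (m : Fin n → ℤ),
    Q.side = (2 : ℝ) ^ (-j) ∧ ∀ i, Q.corner i = (m i : ℝ) * (2 : ℝ) ^ (-j)

end Cube

/-- `η`-sparseness of a collection of cubes: there are pairwise disjoint measurable
subsets `E Q ⊆ Q` with `|E Q| ≥ η |Q|`. -/
def IsSparse {n : ℕ} (η : ℝ) (S : Set (Cube n)) : Prop :=
  ∃ E : Cube n → Set (Fin n → ℝ),
    (∀ Q ∈ S, MeasurableSet (E Q)) ∧ (∀ Q ∈ S, E Q ⊆ Q.carrier) ∧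
    (S.Pairwise (fun Q Q' => Disjoint (E Q) (E Q'))) ∧
    (∀ Q ∈ S, ENNReal.ofReal (η * Q.vol) ≤ volume (E Q))

/-- A weight: a nonnegative locally integrable function on ℝⁿ. -/
def IsWeight {n : ℕ} (w : (Fin n → ℝ) → ℝ) : Prop :=
  MeasureTheory.LocallyIntegrable w volume ∧ ∀ x, 0 ≤ w x

/-- `ω(Q) = ∫_Q ω`. -/
def wMass {n : ℕ} (w : (Fin n → ℝ) → ℝ) (Q : Cube n) : ℝ≥0∞ :=
  ∫⁻ x in Q.carrier, ENNReal.ofReal (w x)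

/-- The weighted `L^s` (quasi)norm `‖f‖_{L^s_w} = (∫ |f|^s w)^{1/s}`, valued in `ℝ≥0∞`. -/
def wNorm {n : ℕ} (s : ℝ) (w f : (Fin n → ℝ) → ℝ) : ℝ≥0∞ :=
  (∫⁻ x, ENNReal.ofReal (|f x| ^ s) * ENNReal.ofReal (w x)) ^ (1 / s)

/-- The weighted `L^s` (quasi)norm of an `ℝ≥0∞`-valued function. -/
def eNorm {n : ℕ} (s : ℝ) (w : (Fin n → ℝ) → ℝ) (g : (Fin n → ℝ) → ℝ≥0∞) : ℝ≥0∞ :=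
  (∫⁻ x, g x ^ s * ENNReal.ofReal (w x)) ^ (1 / s)

/-- `Σ_{Q ∈ D} g(Q) 1_Q`. -/
def cubeSum {n : ℕ} (D : Set (Cube n)) (g : Cube n → ℝ≥0∞) (x : Fin n → ℝ) : ℝ≥0∞ :=
  ∑' Q : D, Q.1.carrier.indicator (fun _ => g Q.1) x

/-- The sparse operator `A^{r,α}_S f = (Σ_{Q∈S} (|Q|^{-α} ∫_Q f)^r 1_Q)^{1/r}`
(for nonnegative `f`; negative values are truncated). -/
def sparseOp {n : ℕ} (S : Set (Cube n)) (r α : ℝ) (f : (Fin n → ℝ) → ℝ)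
    (x : Fin n → ℝ) : ℝ≥0∞ :=
  (cubeSum S
      (fun Q => ((ENNReal.ofReal Q.vol) ^ (-α) * ∫⁻ y in Q.carrier, ENNReal.ofReal (f y)) ^ r)
      x) ^ (1 / r)

/-- The Hardy–Littlewood maximal function over axis-parallel cubes. -/
def maximal {n : ℕ} (w : (Fin n → ℝ) → ℝ) (x : Fin n → ℝ) : ℝ≥0∞ :=
  ⨆ (Q : Cube n) (_ : x ∈ Q.carrier),
    (ENNReal.ofReal Q.vol)⁻¹ * ∫⁻ y in Q.carrier, ENNReal.ofReal |w y|

/-- The Fujii–Wilson `A∞`-characteristic `[w]_{A∞} = sup_Q ω(Q)⁻¹ ∫_Q M(1_Q ω)`. -/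
def AinfChar {n : ℕ} (w : (Fin n → ℝ) → ℝ) : ℝ≥0∞ :=
  ⨆ Q : Cube n, (wMass w Q)⁻¹ * ∫⁻ x in Q.carrier, maximal (Q.carrier.indicator w) x

/-- The two-weight characteristic
`[ω,σ]_{A^α_{pq}(S)} = sup_{Q∈S} |Q|^{-α} ω(Q)^{1/q} σ(Q)^{1/p'}` (here `1/p' = 1 - 1/p`). -/
def twoWeightChar {n : ℕ} (p q α : ℝ) (S : Set (Cube n)) (w σ' : (Fin n → ℝ) → ℝ) : ℝ≥0∞ :=
  ⨆ Q ∈ S, (ENNReal.ofReal Q.vol) ^ (-α) * wMass w Q ^ (1 / q) * wMass σ' Q ^ (1 - 1 / p)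

/-- The one-weight characteristic
`[w]_{A_{pq}} = sup_Q (|Q|⁻¹ ∫_Q w^q)(|Q|⁻¹ ∫_Q w^{-p'})^{q/p'}`, `p' = p/(p-1)`. -/
def ApqChar {n : ℕ} (p q : ℝ) (w : (Fin n → ℝ) → ℝ) : ℝ≥0∞ :=
  ⨆ Q : Cube n,
    ((ENNReal.ofReal Q.vol)⁻¹ * ∫⁻ x in Q.carrier, (ENNReal.ofReal (w x)) ^ q) *
      ((ENNReal.ofReal Q.vol)⁻¹ *
          ∫⁻ x in Q.carrier, (ENNReal.ofReal (w x)) ^ (-(p / (p - 1)))) ^ (q / (p / (p - 1)))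

/-- The testing constant `𝒯`. -/
def testT {n : ℕ} (p q r α : ℝ) (S : Set (Cube n)) (w σ' : (Fin n → ℝ) → ℝ) : ℝ≥0∞ :=
  ⨆ R ∈ S,
    wMass σ' R ^ (-(r / p)) *
      eNorm (q / r) w
        (cubeSum {Q | Q ∈ S ∧ Q.carrier ⊆ R.carrier}
          (fun Q => (ENNReal.ofReal Q.vol) ^ (-(α * r)) * wMass σ' Q ^ r))

/-- The testing constant `𝒯*`; here `1/(q/r)' = 1 - r/q` and `(p/r)' = (p/r)/((p/r)-1)`. -/
def testTstar {n : ℕ} (p q r α : ℝ) (S : Set (Cube n)) (w σ' : (Fin n → ℝ) → ℝ) : ℝ≥0∞ :=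
  ⨆ R ∈ S,
    wMass w R ^ (-(1 - r / q)) *
      eNorm ((p / r) / (p / r - 1)) σ'
        (cubeSum {Q | Q ∈ S ∧ Q.carrier ⊆ R.carrier}
          (fun Q => (ENNReal.ofReal Q.vol) ^ (-(α * r)) * wMass σ' Q ^ (r - 1) * wMass w Q))

/-- The operator (quasi)norm of `A^{r,α}_S(·σ) : L^p_σ → L^q_ω`, i.e. the least constant `K`
with `‖A^{r,α}_S(fσ)‖_{L^q_ω} ≤ K ‖f‖_{L^p_σ}` for all `f`. -/
def sparseOpNorm {n : ℕ} (p q r α : ℝ) (S : Set (Cube n)) (w σ' : (Fin n → ℝ) → ℝ) : ℝ≥0∞ :=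
  sInf {K : ℝ≥0∞ | ∀ f : (Fin n → ℝ) → ℝ, Measurable f →
    eNorm q w (sparseOp S r α (fun y => f y * σ' y)) ≤ K * wNorm p σ' f}

theorem lintegral_layer {p : ℝ} (hp : 0 < p) {a : ℝ≥0∞} (ha : a ≠ ∞) :
    ENNReal.ofReal p *
        ∫⁻ t in Ioi (0 : ℝ), (if ENNReal.ofReal t < a then ENNReal.ofReal (t ^ (p - 1)) else 0) =
      a ^ p := by
  have h := lintegral_rpow_eq_lintegral_meas_lt_mul (Measure.dirac ()) (f := fun _ => a.toReal)
    (ae_of_all _ fun _ => ENNReal.toReal_nonneg) measurable_const.aemeasurable hp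
  rw [lintegral_dirac, ← ENNReal.ofReal_rpow_of_nonneg ENNReal.toReal_nonneg hp.le,
    ENNReal.ofReal_toReal ha] at h
  rw [h]
  congr 1
  refine setLIntegral_congr_fun measurableSet_Ioi fun t ht => ?_
  have : ENNReal.ofReal t < a ↔ t < a.toReal := ENNReal.ofReal_lt_iff_lt_toReal (le_of_lt ht) ha
  by_cases hta : t < a.toReal <;> simp [this, hta]

theorem lintegral_layer_le {p : ℝ} (hp : 0 < p) (a : ℝ≥0∞) :
    ENNReal.ofReal p *
        ∫⁻ t in Ioi (0 : ℝ), (if ENNReal.ofReal t < a then ENNReal.ofReal (t ^ (p - 1)) else 0) ≤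
      a ^ p := by
  rcases eq_or_ne a ∞ with rfl | ha
  · simp [hp]
  · exact (lintegral_layer hp ha).le

section Carleson

variable {X ι : Type*} [MeasurableSpace X] {μ : Measure X} {B : ι → Set X} {F : Finset ι}
  [∀ R, DecidablePred fun Q => B Q ⊆ B R]

theorem mul_sum_measure_level_le
    (hB : ∀ Q ∈ F, MeasurableSet (B Q)) (hfin : ∀ Q ∈ F, μ (B Q) ≠ ∞) (hinj : InjOn B F)
    (hnest : ∀ Q ∈ F, ∀ R ∈ F, B Q ⊆ B R ∨ B R ⊆ B Q ∨ AEDisjoint μ (B Q) (B R))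
    {K : ℝ≥0∞} (hK : ∀ R ∈ F, ∑ Q ∈ F with B Q ⊆ B R, μ (B Q) ≤ K * μ (B R))
    {g : X → ℝ≥0∞} (hg : Measurable g) {l : ℝ≥0∞} (hl : l ≠ ∞) :
    l * ∑ Q ∈ F with l < (μ (B Q))⁻¹ * ∫⁻ x in B Q, g x ∂μ, μ (B Q) ≤
      K * (2 * ∫⁻ x, (if l < 2 * g x then g x else 0) ∂μ) := by
  classical
  set F' := F.filter fun Q => l < (μ (B Q))⁻¹ * ∫⁻ x in B Q, g x ∂μ with hF'
  have hF'F : F' ⊆ F := Finset.filter_subset _ _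
  set P := F'.filter fun R => MaximalFor (· ∈ F') B R with hP
  have hPF : ∀ R ∈ P, R ∈ F := fun R hR => (Finset.mem_filter.1 (Finset.mem_filter.1 hR).1).1
  have hcover : ∀ Q ∈ F', ∃ R ∈ P, B Q ⊆ B R := by
    intro Q hQ
    obtain ⟨R, hR⟩ := Finset.exists_maximalFor B (F'.filter fun R : ι => B Q ⊆ B R)
      ⟨Q, Finset.mem_filter.2 ⟨hQ, Subset.rfl⟩⟩
    have hR1 := Finset.mem_filter.1 hR.1
    refine ⟨R, Finset.mem_filter.2 ⟨hR1.1, hR1.1, fun T hT hRT => ?_⟩, hR1.2⟩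
    exact hR.2 (Finset.mem_filter.2 ⟨hT, hR1.2.trans hRT⟩) hRT
  have hdisj : (P : Set ι).Pairwise (Function.onFun (AEDisjoint μ) B) := by
    intro Q hQ R hR hQR
    have hQ' := Finset.mem_filter.1 hQ
    have hR' := Finset.mem_filter.1 hR
    rcases hnest Q (hPF Q hQ) R (hPF R hR) with h | h | h
    · exact absurd (hinj (hPF Q hQ) (hPF R hR) (h.antisymm (hQ'.2.2 hR'.1 h))) hQR
    · exact absurd (hinj (hPF Q hQ) (hPF R hR) ((hR'.2.2 hQ'.1 h).antisymm h)) hQR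
    · exact h
  have hsum : ∑ Q ∈ F', μ (B Q) ≤ ∑ R ∈ P, K * μ (B R) := by
    calc ∑ Q ∈ F', μ (B Q)
        ≤ ∑ Q ∈ F', ∑ R ∈ P, (if B Q ⊆ B R then μ (B Q) else 0) := by
          refine Finset.sum_le_sum fun Q hQ => ?_
          obtain ⟨R, hR, hQR⟩ := hcover Q hQ
          refine le_trans ?_ (Finset.single_le_sum (fun _ _ => zero_le) hR)
          simp [hQR]
      _ = ∑ R ∈ P, ∑ Q ∈ F', (if B Q ⊆ B R then μ (B Q) else 0) := Finset.sum_comm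
      _ ≤ ∑ R ∈ P, K * μ (B R) := by
          refine Finset.sum_le_sum fun R hR => le_trans ?_ (hK R (hPF R hR))
          rw [Finset.sum_filter fun Q => B Q ⊆ B R]
          exact Finset.sum_le_sum_of_subset hF'F
  have hweak : ∀ R ∈ P, l * μ (B R) ≤ 2 * ∫⁻ x in B R, (if l < 2 * g x then g x else 0) ∂μ := by
    intro R hR
    have hRF := hPF R hR
    have hlt := (Finset.mem_filter.1 (Finset.mem_filter.1 hR).1).2
    rcases eq_or_ne (μ (B R)) 0 with h0 | h0
    · simp [h0]
    have h1 : l * μ (B R) ≤ ∫⁻ x in B R, g x ∂μ := by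
      have := ENNReal.mul_le_of_le_div (hlt.le.trans_eq (by rw [mul_comm, div_eq_mul_inv]))
      exact this
    have hlfin : l * μ (B R) ≠ ∞ := ENNReal.mul_ne_top hl (hfin R hRF)
    have h2 : 2 * ∫⁻ x in B R, g x ∂μ ≤
        2 * (∫⁻ x in B R, (if l < 2 * g x then g x else 0) ∂μ) + l * μ (B R) := by
      rw [← lintegral_const_mul _ hg, ← lintegral_const_mul' _ _ (by simp),
        ← setLIntegral_const, ← lintegral_add_right _ measurable_const]
      refine lintegral_mono fun x => ?_
      dsimp only
      split_ifs with h
      · exact le_self_add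
      · simpa using h
    have h3 : l * μ (B R) + l * μ (B R) ≤
        2 * (∫⁻ x in B R, (if l < 2 * g x then g x else 0) ∂μ) + l * μ (B R) := by
      refine le_trans ?_ h2
      rw [← two_mul]
      gcongr
    exact (ENNReal.add_le_add_iff_right hlfin).1 h3
  calc l * ∑ Q ∈ F', μ (B Q) ≤ l * ∑ R ∈ P, K * μ (B R) := by gcongr
    _ = K * ∑ R ∈ P, l * μ (B R) := by
        rw [← Finset.mul_sum, ← Finset.mul_sum]; ring
    _ ≤ K * ∑ R ∈ P, 2 * ∫⁻ x in B R, (if l < 2 * g x then g x else 0) ∂μ := by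
        gcongr K * ?_
        exact Finset.sum_le_sum hweak
    _ = K * (2 * ∫⁻ x in ⋃ R ∈ P, B R, (if l < 2 * g x then g x else 0) ∂μ) := by
        rw [← Finset.mul_sum, lintegral_biUnion_finset₀ hdisj
          fun R hR => (hB R (hPF R hR)).nullMeasurableSet]
    _ ≤ _ := by
        gcongr
        exact Measure.restrict_le_self

/-- The Carleson embedding theorem for finite families of nested or disjoint sets. -/
theorem carleson_embedding [SFinite μ]
    (hB : ∀ Q ∈ F, MeasurableSet (B Q)) (hfin : ∀ Q ∈ F, μ (B Q) ≠ ∞) (hinj : InjOn B F)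
    (hnest : ∀ Q ∈ F, ∀ R ∈ F, B Q ⊆ B R ∨ B R ⊆ B Q ∨ AEDisjoint μ (B Q) (B R))
    {K : ℝ≥0∞} (hK : ∀ R ∈ F, ∑ Q ∈ F with B Q ⊆ B R, μ (B Q) ≤ K * μ (B R))
    {g : X → ℝ≥0∞} (hg : Measurable g) (hgfin : ∀ Q ∈ F, ∫⁻ x in B Q, g x ∂μ ≠ ∞)
    {q : ℝ} (hq : 1 < q) :
    ∑ Q ∈ F, μ (B Q) * ((μ (B Q))⁻¹ * ∫⁻ x in B Q, g x ∂μ) ^ q ≤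
      ENNReal.ofReal (q * 2 ^ q / (q - 1)) * K * ∫⁻ x, g x ^ q ∂μ := by
  have hq0 : 0 < q := by linarith
  have hq1 : 0 < q - 1 := by linarith
  set a : ι → ℝ≥0∞ := fun Q => (μ (B Q))⁻¹ * ∫⁻ x in B Q, g x ∂μ with ha
  have hafin : ∀ Q ∈ F, a Q ≠ ∞ := by
    intro Q hQ
    rcases eq_or_ne (μ (B Q)) 0 with h0 | h0
    · simp [ha, Measure.restrict_eq_zero.2 h0]
    · exact ENNReal.mul_ne_top (ENNReal.inv_ne_top.2 h0) (hgfin Q hQ)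
  have hm : ∀ (b : ℝ≥0∞) (s : ℝ), Measurable fun t : ℝ =>
      if ENNReal.ofReal t < b then ENNReal.ofReal (t ^ s) else 0 := fun b s =>
    Measurable.ite (measurableSet_lt (by fun_prop) measurable_const) (by fun_prop)
      measurable_const
  have key : ∀ t ∈ Ioi (0 : ℝ),
      (∑ Q ∈ F, μ (B Q) * if ENNReal.ofReal t < a Q then ENNReal.ofReal (t ^ (q - 1)) else 0) ≤
        K * ∫⁻ x, 2 * g x *
          (if ENNReal.ofReal t < 2 * g x then ENNReal.ofReal (t ^ (q - 1 - 1)) else 0) ∂μ := by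
    intro t ht
    have ht' : (0 : ℝ) < t := ht
    have h := mul_sum_measure_level_le hB hfin hinj hnest hK hg (l := ENNReal.ofReal t)
      ENNReal.ofReal_ne_top
    have hpow : ENNReal.ofReal (t ^ (q - 1)) =
        ENNReal.ofReal (t ^ (q - 1 - 1)) * ENNReal.ofReal t := by
      rw [← ENNReal.ofReal_mul (by positivity), ← Real.rpow_add_one ht'.ne']
      ring_nf
    calc (∑ Q ∈ F, μ (B Q) * if ENNReal.ofReal t < a Q then ENNReal.ofReal (t ^ (q - 1)) else 0)
        = ENNReal.ofReal (t ^ (q - 1 - 1)) *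
            (ENNReal.ofReal t * ∑ Q ∈ F with ENNReal.ofReal t < a Q, μ (B Q)) := by
          rw [← mul_assoc, ← hpow, Finset.sum_filter, Finset.mul_sum]
          refine Finset.sum_congr rfl fun Q _ => ?_
          split_ifs <;> simp [mul_comm]
      _ ≤ ENNReal.ofReal (t ^ (q - 1 - 1)) * (K *
            (2 * ∫⁻ x, (if ENNReal.ofReal t < 2 * g x then g x else 0) ∂μ)) := by gcongr
      _ = _ := by
          rw [← mul_assoc, mul_comm _ K, mul_assoc, ← lintegral_const_mul' _ _ (by simp),
            ← lintegral_const_mul' _ _ (by simp)]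
          congr 2
          funext x
          split_ifs
          · ring
          · simp
  have hmeas : Measurable (Function.uncurry fun (t : ℝ) (x : X) => 2 * g x *
      (if ENNReal.ofReal t < 2 * g x then ENNReal.ofReal (t ^ (q - 1 - 1)) else 0)) := by
    refine Measurable.mul (by fun_prop) (Measurable.ite ?_ (by fun_prop) measurable_const)
    exact measurableSet_lt (by fun_prop) (by fun_prop)
  calc ∑ Q ∈ F, μ (B Q) * a Q ^ q
      = ENNReal.ofReal q * ∫⁻ t in Ioi (0 : ℝ), ∑ Q ∈ F, μ (B Q) *
          if ENNReal.ofReal t < a Q then ENNReal.ofReal (t ^ (q - 1)) else 0 := by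
        rw [lintegral_finsetSum _ fun Q _ => (hm _ _).const_mul _, Finset.mul_sum]
        refine Finset.sum_congr rfl fun Q hQ => ?_
        rw [lintegral_const_mul _ (hm _ _), ← lintegral_layer hq0 (hafin Q hQ)]
        ring
    _ ≤ ENNReal.ofReal q * ∫⁻ t in Ioi (0 : ℝ), K * ∫⁻ x, 2 * g x *
          (if ENNReal.ofReal t < 2 * g x then ENNReal.ofReal (t ^ (q - 1 - 1)) else 0) ∂μ := by
        gcongr ENNReal.ofReal q * ?_
        exact setLIntegral_mono' measurableSet_Ioi key
    _ = ENNReal.ofReal q * (K * ∫⁻ x, 2 * g x * (∫⁻ t in Ioi (0 : ℝ),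
          if ENNReal.ofReal t < 2 * g x then ENNReal.ofReal (t ^ (q - 1 - 1)) else 0) ∂μ) := by
        rw [lintegral_const_mul _ hmeas.lintegral_prod_right,
          lintegral_lintegral_swap hmeas.aemeasurable]
        congr 3
        funext x
        rw [lintegral_const_mul _ (hm _ _)]
    _ ≤ ENNReal.ofReal q * (K * ∫⁻ x, ENNReal.ofReal (2 ^ q / (q - 1)) * g x ^ q ∂μ) := by
        gcongr ENNReal.ofReal q * (K * ?_)
        refine lintegral_mono fun x => ?_
        have h := lintegral_layer_le hq1 (2 * g x)
        have hne : ENNReal.ofReal (q - 1) ≠ 0 := by simpa using hq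
        have h2 : ∀ y : ℝ≥0∞, y * y ^ (q - 1) = y ^ q := fun y => by
          nth_rewrite 1 [← ENNReal.rpow_one y]
          rw [← ENNReal.rpow_add_of_nonneg _ _ zero_le_one hq1.le]
          ring_nf
        rw [mul_comm] at h
        have h3 := (ENNReal.le_div_iff_mul_le (Or.inl hne) (Or.inl ENNReal.ofReal_ne_top)).2 h
        calc _ ≤ 2 * g x * ((2 * g x) ^ (q - 1) / ENNReal.ofReal (q - 1)) := by gcongr
          _ = (2 * g x) ^ q / ENNReal.ofReal (q - 1) := by rw [← mul_div_assoc, h2]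
          _ = _ := by
            rw [ENNReal.mul_rpow_of_nonneg _ _ hq0.le, ENNReal.ofReal_div_of_pos hq1,
              ← ENNReal.ofReal_rpow_of_pos two_pos]
            simp only [div_eq_mul_inv, ENNReal.ofReal_ofNat]
            ring
    _ = _ := by
        rw [lintegral_const_mul _ (by fun_prop), mul_div_assoc, ENNReal.ofReal_mul hq0.le]
        ring

end Carleson

namespace Cube

variable {n : ℕ}

theorem carrier_eq_Icc (Q : Cube n) :
    Q.carrier = Icc Q.corner (fun i => Q.corner i + Q.side) := by
  ext x
  simp [carrier, Pi.le_def, forall_and]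

theorem measurableSet_carrier (Q : Cube n) : MeasurableSet Q.carrier := by
  rw [carrier_eq_Icc]
  exact measurableSet_Icc

theorem isCompact_carrier (Q : Cube n) : IsCompact Q.carrier := by
  rw [carrier_eq_Icc]
  exact isCompact_Icc

theorem vol_pos (Q : Cube n) : 0 < Q.vol := pow_pos Q.side_pos n

theorem carrier_injective (hn : 1 ≤ n) : Function.Injective (carrier (n := n)) := by
  intro Q R h
  have hle : ∀ T : Cube n, T.corner ≤ fun i => T.corner i + T.side := fun T i =>
    le_add_of_nonneg_right T.side_pos.le
  rw [carrier_eq_Icc, carrier_eq_Icc] at h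
  have h1 : Q.corner = R.corner :=
    (isLeast_Icc (hle Q)).unique (h ▸ isLeast_Icc (hle R))
  have h2 : (fun i => Q.corner i + Q.side) = fun i => R.corner i + R.side :=
    (isGreatest_Icc (hle Q)).unique (h ▸ isGreatest_Icc (hle R))
  have h3 := congrFun h2 ⟨0, hn⟩
  rw [h1] at h3
  cases Q; cases R; simp_all

theorem IsDyadic.nested_of_side_le {Q R : Cube n} (hQ : Q.IsDyadic) (hR : R.IsDyadic)
    (hle : Q.side ≤ R.side) :
    Q.carrier ⊆ R.carrier ∨ AEDisjoint volume Q.carrier R.carrier := by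
  obtain ⟨j, m, hQs, hQc⟩ := hQ
  obtain ⟨k, l, hRs, hRc⟩ := hR
  rw [hQs, hRs, zpow_le_zpow_iff_right₀ (_root_.one_lt_two (α := ℝ))] at hle
  obtain ⟨N, hN⟩ : ∃ N : ℕ, j - k = N := ⟨(j - k).toNat, by omega⟩
  set d : ℝ := (2 : ℝ) ^ (-j) with hd
  have hdpos : 0 < d := by positivity
  have hkd : (2 : ℝ) ^ (-k) = ((2 ^ N : ℤ) : ℝ) * d := by
    rw [hd, show -k = (N : ℤ) + -j by omega, zpow_add₀ two_ne_zero]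
    push_cast
    simp
  rw [hkd] at hRs
  simp only [hkd] at hRc
  generalize (2 ^ N : ℤ) = M at *
  by_cases h : ∀ i, l i * M ≤ m i ∧ m i + 1 ≤ l i * M + M
  · left
    intro x hx i
    have h1 : ((l i * M : ℤ) : ℝ) * d ≤ (m i : ℝ) * d := by
      have : ((l i * M : ℤ) : ℝ) ≤ m i := by exact_mod_cast (h i).1
      gcongr
    have h2 : ((m i + 1 : ℤ) : ℝ) * d ≤ ((l i * M + M : ℤ) : ℝ) * d := by
      have : ((m i + 1 : ℤ) : ℝ) ≤ ((l i * M + M : ℤ) : ℝ) := by exact_mod_cast (h i).2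
      gcongr
    have := hx i
    rw [hQc, hQs] at this
    rw [hRc, hRs]
    push_cast at h1 h2
    constructor <;> nlinarith
  · right
    push Not at h
    obtain ⟨i, hi⟩ := h
    have hyper : ∀ c : ℝ, Q.carrier ∩ R.carrier ⊆ {x | x i = c} →
        AEDisjoint volume Q.carrier R.carrier := fun c hc =>
      measure_mono_null hc (Measure.pi_hyperplane (α := fun _ => ℝ) (fun _ => volume) i c)
    by_cases h1 : l i * M ≤ m i
    · have h2 : l i * M + M ≤ m i := by have := hi h1; omega
      refine hyper (m i * d) fun x hx => ?_
      have hx1 := hx.1 i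
      have hx2 := hx.2 i
      rw [hQc, hQs] at hx1
      rw [hRc, hRs] at hx2
      have h3 : ((l i * M + M : ℤ) : ℝ) * d ≤ (m i : ℝ) * d := by
        have : ((l i * M + M : ℤ) : ℝ) ≤ m i := by exact_mod_cast h2
        gcongr
      push_cast at h3
      exact le_antisymm (by nlinarith) hx1.1
    · have h2 : m i + 1 ≤ l i * M := by omega
      refine hyper ((m i + 1) * d) fun x hx => ?_
      have hx1 := hx.1 i
      have hx2 := hx.2 i
      rw [hQc, hQs] at hx1
      rw [hRc, hRs] at hx2
      have h3 : ((m i + 1 : ℤ) : ℝ) * d ≤ ((l i * M : ℤ) : ℝ) * d := by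
        have : ((m i + 1 : ℤ) : ℝ) ≤ ((l i * M : ℤ) : ℝ) := by exact_mod_cast h2
        gcongr
      push_cast at h3
      exact le_antisymm (by nlinarith) (by nlinarith)

theorem IsDyadic.nested {Q R : Cube n} (hQ : Q.IsDyadic) (hR : R.IsDyadic) :
    Q.carrier ⊆ R.carrier ∨ R.carrier ⊆ Q.carrier ∨
      AEDisjoint volume Q.carrier R.carrier := by
  rcases le_total Q.side R.side with h | h
  · exact (hQ.nested_of_side_le hR h).imp_right Or.inr
  · exact Or.inr ((hR.nested_of_side_le hQ h).imp_right AEDisjoint.symm)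

theorem countable_of_isDyadic {S : Set (Cube n)} (hS : ∀ Q ∈ S, Q.IsDyadic) : S.Countable := by
  have : S ⊆ range fun p : ℤ × (Fin n → ℤ) =>
      (⟨fun i => (p.2 i : ℝ) * (2 : ℝ) ^ (-p.1), (2 : ℝ) ^ (-p.1), by positivity⟩ : Cube n) := by
    intro Q hQ
    obtain ⟨j, m, hs, hc⟩ := hS Q hQ
    refine ⟨(j, m), ?_⟩
    cases Q
    simp only [mk.injEq]
    exact ⟨(funext hc).symm, hs.symm⟩
  exact (countable_range _).mono this

end Cube

/-- The measure `w dx`. -/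
def weightMeasure {n : ℕ} (w : (Fin n → ℝ) → ℝ) : Measure (Fin n → ℝ) :=
  volume.withDensity fun x => ENNReal.ofReal (w x)

instance {n : ℕ} (w : (Fin n → ℝ) → ℝ) : SFinite (weightMeasure w) := by
  unfold weightMeasure
  infer_instance

section Weight

variable {n : ℕ} {w : (Fin n → ℝ) → ℝ}

theorem weightMeasure_carrier (w : (Fin n → ℝ) → ℝ) (Q : Cube n) :
    weightMeasure w Q.carrier = wMass w Q :=
  withDensity_apply _ Q.measurableSet_carrier

theorem IsWeight.aemeasurable (hw : IsWeight w) :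
    AEMeasurable (fun x => ENNReal.ofReal (w x)) :=
  hw.1.aestronglyMeasurable.aemeasurable.ennreal_ofReal

theorem IsWeight.wMass_ne_top (hw : IsWeight w) (Q : Cube n) : wMass w Q ≠ ∞ := by
  have h := (hw.1.integrableOn_isCompact Q.isCompact_carrier).2
  refine ((lintegral_mono fun x => ?_).trans_lt h).ne
  rw [← ofReal_norm]
  exact ENNReal.ofReal_le_ofReal (Real.le_norm_self _)

theorem IsWeight.lintegral_weightMeasure (hw : IsWeight w) {g : (Fin n → ℝ) → ℝ≥0∞}
    (hg : Measurable g) :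
    ∫⁻ x, g x ∂weightMeasure w = ∫⁻ x, g x * ENNReal.ofReal (w x) := by
  rw [weightMeasure, lintegral_withDensity_eq_lintegral_mul₀ hw.aemeasurable hg.aemeasurable]
  simp only [Pi.mul_apply, mul_comm]

theorem IsWeight.setLIntegral_weightMeasure (hw : IsWeight w) {g : (Fin n → ℝ) → ℝ≥0∞}
    (hg : Measurable g) (Q : Cube n) :
    ∫⁻ x in Q.carrier, g x ∂weightMeasure w =
      ∫⁻ x in Q.carrier, g x * ENNReal.ofReal (w x) := by
  rw [weightMeasure, setLIntegral_withDensity_eq_lintegral_mul₀ hw.aemeasurable hg.aemeasurable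
    Q.measurableSet_carrier]
  simp only [Pi.mul_apply, mul_comm]

theorem lintegral_maximal_le (hw : IsWeight w) {R : Cube n} (h0 : wMass w R ≠ 0) :
    ∫⁻ x in R.carrier, maximal (R.carrier.indicator w) x ≤ AinfChar w * wMass w R := by
  have h : (wMass w R)⁻¹ * ∫⁻ x in R.carrier, maximal (R.carrier.indicator w) x ≤ AinfChar w :=
    le_iSup (fun Q : Cube n =>
      (wMass w Q)⁻¹ * ∫⁻ x in Q.carrier, maximal (Q.carrier.indicator w) x) R
  rwa [ENNReal.inv_mul_le_iff h0 (hw.wMass_ne_top R), mul_comm] at h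

/-- The Carleson packing condition for sparse families and `A∞` weights. -/
theorem sum_wMass_le {S : Set (Cube n)} {η : ℝ} (hη : 0 < η) (hS : IsSparse η S)
    (hw : IsWeight w) {F : Finset (Cube n)} (hF : (F : Set (Cube n)) ⊆ S) (R : Cube n)
    [DecidablePred fun Q : Cube n => Q.carrier ⊆ R.carrier] :
    ∑ Q ∈ F with Q.carrier ⊆ R.carrier, wMass w Q ≤
      (ENNReal.ofReal η)⁻¹ * AinfChar w * wMass w R := by
  obtain ⟨E, hEm, hEsub, hEdisj, hEvol⟩ := hS
  set G := F.filter fun Q => Q.carrier ⊆ R.carrier with hG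
  have hGS : ∀ Q ∈ G, Q ∈ S := fun Q hQ => hF (Finset.mem_filter.1 hQ).1
  have hGR : ∀ Q ∈ G, Q.carrier ⊆ R.carrier := fun Q hQ => (Finset.mem_filter.1 hQ).2
  have hη0 : ENNReal.ofReal η ≠ 0 := by simpa using hη
  rcases eq_or_ne (wMass w R) 0 with h0 | h0
  · refine (Finset.sum_eq_zero fun Q hQ => ?_).trans_le zero_le
    exact le_antisymm ((lintegral_mono_set (hGR Q hQ)).trans_eq h0) zero_le
  have hQ : ∀ Q ∈ G, ENNReal.ofReal η * wMass w Q ≤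
      ∫⁻ x in E Q, maximal (R.carrier.indicator w) x := by
    intro Q hQ
    have hvol0 : ENNReal.ofReal Q.vol ≠ 0 := by simpa using Q.vol_pos
    have hmass : wMass w Q ≤ ∫⁻ y in Q.carrier, ENNReal.ofReal |R.carrier.indicator w y| := by
      refine setLIntegral_mono' Q.measurableSet_carrier fun y hy => ?_
      rw [indicator_of_mem (hGR Q hQ hy)]
      exact ENNReal.ofReal_le_ofReal (le_abs_self _)
    calc ENNReal.ofReal η * wMass w Q
        = (ENNReal.ofReal Q.vol)⁻¹ * wMass w Q * ENNReal.ofReal (η * Q.vol) := by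
          rw [ENNReal.ofReal_mul hη.le, mul_comm (ENNReal.ofReal η) (ENNReal.ofReal Q.vol),
            ← mul_assoc, mul_right_comm _ _ (ENNReal.ofReal Q.vol),
            ENNReal.inv_mul_cancel hvol0 ENNReal.ofReal_ne_top, one_mul, mul_comm]
      _ ≤ (ENNReal.ofReal Q.vol)⁻¹ * (∫⁻ y in Q.carrier,
            ENNReal.ofReal |R.carrier.indicator w y|) * volume (E Q) := by
          gcongr
          exact hEvol Q (hGS Q hQ)
      _ = ∫⁻ _ in E Q, (ENNReal.ofReal Q.vol)⁻¹ * ∫⁻ y in Q.carrier,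
            ENNReal.ofReal |R.carrier.indicator w y| := by rw [setLIntegral_const]
      _ ≤ _ := by
          refine setLIntegral_mono' (hEm Q (hGS Q hQ)) fun x hx => ?_
          exact le_iSup₂ (f := fun (T : Cube n) (_ : x ∈ T.carrier) =>
            (ENNReal.ofReal T.vol)⁻¹ * ∫⁻ y in T.carrier,
              ENNReal.ofReal |R.carrier.indicator w y|) Q (hEsub Q (hGS Q hQ) hx)
  have hmain : ENNReal.ofReal η * ∑ Q ∈ G, wMass w Q ≤ AinfChar w * wMass w R := by
    calc ENNReal.ofReal η * ∑ Q ∈ G, wMass w Q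
        ≤ ∑ Q ∈ G, ∫⁻ x in E Q, maximal (R.carrier.indicator w) x := by
          rw [Finset.mul_sum]
          exact Finset.sum_le_sum hQ
      _ = ∫⁻ x in ⋃ Q ∈ G, E Q, maximal (R.carrier.indicator w) x := by
          rw [lintegral_biUnion_finset (fun Q hQ T hT => hEdisj (hGS Q hQ) (hGS T hT))
            fun Q hQ => hEm Q (hGS Q hQ)]
      _ ≤ ∫⁻ x in R.carrier, maximal (R.carrier.indicator w) x :=
          lintegral_mono_set (iUnion₂_subset fun Q hQ =>
            (hEsub Q (hGS Q hQ)).trans (hGR Q hQ))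
      _ ≤ _ := lintegral_maximal_le hw h0
  rw [mul_assoc, mul_comm (ENNReal.ofReal η)⁻¹, ← div_eq_mul_inv,
    ENNReal.le_div_iff_mul_le (Or.inl hη0) (Or.inl ENNReal.ofReal_ne_top), mul_comm]
  exact hmain

theorem carleson_embedding_weight (hn : 1 ≤ n) {S : Set (Cube n)} (hSd : ∀ Q ∈ S, Q.IsDyadic)
    {η : ℝ} (hη : 0 < η) (hS : IsSparse η S) (hw : IsWeight w) {F : Finset (Cube n)}
    (hF : (F : Set (Cube n)) ⊆ S) {g : (Fin n → ℝ) → ℝ≥0∞} (hg : Measurable g)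
    (hgfin : ∀ Q ∈ F, ∫⁻ x in Q.carrier, g x ∂weightMeasure w ≠ ∞) {q : ℝ} (hq : 1 < q) :
    ∑ Q ∈ F, wMass w Q * ((wMass w Q)⁻¹ * ∫⁻ x in Q.carrier, g x ∂weightMeasure w) ^ q ≤
      ENNReal.ofReal (q * 2 ^ q / (q - 1)) * ((ENNReal.ofReal η)⁻¹ * AinfChar w) *
        ∫⁻ x, g x ^ q ∂weightMeasure w := by
  classical
  simp only [← weightMeasure_carrier]
  refine carleson_embedding (fun Q _ => Q.measurableSet_carrier)
    (fun Q _ => by rw [weightMeasure_carrier]; exact hw.wMass_ne_top Q)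
    (Cube.carrier_injective hn).injOn (fun Q hQ R hR => ?_) (fun R _ => ?_) hg hgfin hq
  · exact ((hSd Q (hF hQ)).nested (hSd R (hF hR))).imp_right
      (Or.imp_right fun h => withDensity_absolutelyContinuous _ _ h)
  · simp only [weightMeasure_carrier]
    exact sum_wMass_le hη hS hw hF R

end Weight

section Sparse

variable {n : ℕ} {p r α : ℝ} {S : Set (Cube n)} {ω σ' : (Fin n → ℝ) → ℝ}

theorem coeff_mul_wMass_le (hp : 1 < p) (hr : 0 < r)
    (hω : IsWeight ω) (hσ : IsWeight σ') {Q : Cube n} (hQ : Q ∈ S) (g : (Fin n → ℝ) → ℝ≥0∞) :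
    (ENNReal.ofReal Q.vol ^ (-α) * ∫⁻ y in Q.carrier, g y ∂weightMeasure σ') ^ r * wMass ω Q ≤
      twoWeightChar p p α S ω σ' ^ r * (wMass ω Q ^ (1 - r / p) * (wMass σ' Q ^ (r / p) *
        ((wMass σ' Q)⁻¹ * ∫⁻ y in Q.carrier, g y ∂weightMeasure σ') ^ r)) := by
  have hp0 : 0 < p := by linarith
  rcases eq_or_ne (wMass σ' Q) 0 with hs | hs
  · have : (weightMeasure σ').restrict Q.carrier = 0 := by
      rw [Measure.restrict_eq_zero, weightMeasure_carrier, hs]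
    simp [this, hr]
  rcases eq_or_ne (wMass ω Q) 0 with hw | hw
  · simp [hw]
  have hs' := hσ.wMass_ne_top Q
  have hw' := hω.wMass_ne_top Q
  have hA : ENNReal.ofReal Q.vol ^ (-α) * wMass ω Q ^ (1 / p) * wMass σ' Q ^ (1 - 1 / p) ≤
      twoWeightChar p p α S ω σ' :=
    le_iSup₂ (f := fun (Q : Cube n) (_ : Q ∈ S) =>
      ENNReal.ofReal Q.vol ^ (-α) * wMass ω Q ^ (1 / p) * wMass σ' Q ^ (1 - 1 / p)) Q hQ
  set v := ENNReal.ofReal Q.vol ^ (-α)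
  set T := ∫⁻ y in Q.carrier, g y ∂weightMeasure σ'
  have hsplitω : wMass ω Q = (wMass ω Q ^ (1 / p)) ^ r * wMass ω Q ^ (1 - r / p) := by
    rw [← ENNReal.rpow_mul, ← ENNReal.rpow_add _ _ hw hw', show 1 / p * r + (1 - r / p) = 1 by
      ring, ENNReal.rpow_one]
  have hsplitσ : T ^ r = (wMass σ' Q ^ (1 - 1 / p)) ^ r *
      (wMass σ' Q ^ (r / p) * ((wMass σ' Q)⁻¹ * T) ^ r) := by
    rw [← mul_assoc, ← ENNReal.rpow_mul, ← ENNReal.rpow_add _ _ hs hs',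
      show (1 - 1 / p) * r + r / p = r by ring, ← ENNReal.mul_rpow_of_nonneg _ _ hr.le,
      ← mul_assoc, ENNReal.mul_inv_cancel hs hs', one_mul]
  calc (v * T) ^ r * wMass ω Q
      = v ^ r * T ^ r * wMass ω Q := by rw [ENNReal.mul_rpow_of_nonneg _ _ hr.le]
    _ = (v * wMass ω Q ^ (1 / p) * wMass σ' Q ^ (1 - 1 / p)) ^ r *
          (wMass ω Q ^ (1 - r / p) *
            (wMass σ' Q ^ (r / p) * ((wMass σ' Q)⁻¹ * T) ^ r)) := by
        rw [ENNReal.mul_rpow_of_nonneg _ _ hr.le, ENNReal.mul_rpow_of_nonneg _ _ hr.le, hsplitσ]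
        nth_rewrite 1 [hsplitω]
        ring
    _ ≤ _ := by gcongr

/-- The sparse bound for finite subfamilies. -/
theorem lintegral_finset_sum_le (hn : 1 ≤ n) {η : ℝ}
    (hp : 1 < p) (hr : 0 < r) (hrp : r < p) (hη : 0 < η)
    (hSd : ∀ Q ∈ S, Q.IsDyadic) (hS : IsSparse η S) (hω : IsWeight ω) (hσ : IsWeight σ')
    {g : (Fin n → ℝ) → ℝ≥0∞} (hg : Measurable g)
    (hgp : ∫⁻ x, g x ^ p ∂weightMeasure σ' ≠ ∞) {F : Finset (Cube n)}
    (hF : (F : Set (Cube n)) ⊆ S) :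
    (∫⁻ x, (∑ Q ∈ F, Q.carrier.indicator (fun _ => (ENNReal.ofReal Q.vol ^ (-α) *
        ∫⁻ y in Q.carrier, g y ∂weightMeasure σ') ^ r) x) ^ (p / r) ∂weightMeasure ω) ^ (r / p) ≤
      twoWeightChar p p α S ω σ' ^ r *
        ((ENNReal.ofReal (p / (p - r) * 2 ^ (p / (p - r)) / (p / (p - r) - 1)) *
            ((ENNReal.ofReal η)⁻¹ * AinfChar ω)) ^ (1 - r / p) *
          (ENNReal.ofReal (p * 2 ^ p / (p - 1)) * ((ENNReal.ofReal η)⁻¹ * AinfChar σ') *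
            ∫⁻ x, g x ^ p ∂weightMeasure σ') ^ (r / p)) := by
  have hp0 : 0 < p := by linarith
  have hpr : 0 < p - r := by linarith
  set c : Cube n → ℝ≥0∞ := fun Q => (ENNReal.ofReal Q.vol ^ (-α) *
        ∫⁻ y in Q.carrier, g y ∂weightMeasure σ') ^ r with hc
  set h : (Fin n → ℝ) → ℝ≥0∞ := fun x => ∑ Q ∈ F, Q.carrier.indicator (fun _ => c Q) x with hh
  set s := p / r with hs
  set q := p / (p - r) with hq
  have hs1 : 1 < s := (one_lt_div hr).2 hrp
  have hq1 : 1 < q := (one_lt_div hpr).2 (by linarith)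
  have hconj : q.HolderConjugate s := by
    rw [Real.holderConjugate_iff]
    refine ⟨hq1, ?_⟩
    rw [hq, hs]
    field_simp
    ring
  have hgfin : ∀ Q : Cube n, ∫⁻ y in Q.carrier, g y ∂weightMeasure σ' ≠ ∞ := by
    intro Q
    have hle : ∫⁻ y in Q.carrier, g y ∂weightMeasure σ' ≤
        ∫⁻ y in Q.carrier, (1 + g y ^ p) ∂weightMeasure σ' := by
      refine lintegral_mono fun y => ?_
      rcases le_total (g y) 1 with h1 | h1
      · exact h1.trans le_self_add
      · refine le_trans ?_ le_add_self
        simpa using ENNReal.rpow_le_rpow_of_exponent_le h1 hp.le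
    refine ne_top_of_le_ne_top ?_ hle
    rw [lintegral_add_left measurable_const, setLIntegral_const, weightMeasure_carrier, one_mul]
    exact ENNReal.add_ne_top.2 ⟨hσ.wMass_ne_top Q,
      ne_top_of_le_ne_top hgp (setLIntegral_le_lintegral _ _)⟩
  have hcfin : ∀ Q, c Q ≠ ∞ := by
    intro Q
    refine ENNReal.rpow_ne_top_of_nonneg hr.le (ENNReal.mul_ne_top ?_ (hgfin Q))
    exact ENNReal.rpow_ne_top_of_ne_zero (by simpa using Q.vol_pos) ENNReal.ofReal_ne_top
  have hhm : Measurable h :=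
    Finset.measurable_sum _ fun Q _ => measurable_const.indicator Q.measurableSet_carrier
  have hhle : ∀ x, h x ≤ ∑ Q ∈ F, c Q := fun x =>
    Finset.sum_le_sum fun Q _ => indicator_le_self _ _ _
  have hhpm : Measurable fun x => h x ^ (s - 1) := hhm.pow_const _
  have hhfin : ∀ Q : Cube n, ∫⁻ x in Q.carrier, h x ^ (s - 1) ∂weightMeasure ω ≠ ∞ := by
    intro Q
    have hle : ∫⁻ x in Q.carrier, h x ^ (s - 1) ∂weightMeasure ω ≤
        ∫⁻ _ in Q.carrier, (∑ Q ∈ F, c Q) ^ (s - 1) ∂weightMeasure ω :=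
      lintegral_mono fun x => ENNReal.rpow_le_rpow (hhle x) (by linarith)
    refine ne_top_of_le_ne_top ?_ hle
    rw [setLIntegral_const, weightMeasure_carrier]
    exact ENNReal.mul_ne_top (ENNReal.rpow_ne_top_of_nonneg (by linarith)
      (ENNReal.sum_ne_top.2 fun Q _ => hcfin Q)) (hω.wMass_ne_top Q)
  have hI : ∫⁻ x, h x ^ s ∂weightMeasure ω =
      ∑ Q ∈ F, c Q * ∫⁻ x in Q.carrier, h x ^ (s - 1) ∂weightMeasure ω := by
    calc ∫⁻ x, h x ^ s ∂weightMeasure ω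
        = ∫⁻ x, ∑ Q ∈ F, Q.carrier.indicator (fun x => c Q * h x ^ (s - 1)) x
            ∂weightMeasure ω := by
          refine lintegral_congr fun x => ?_
          have : h x ^ s = h x * h x ^ (s - 1) := by
            nth_rewrite 2 [← ENNReal.rpow_one (h x)]
            rw [← ENNReal.rpow_add_of_nonneg _ _ zero_le_one (by linarith)]
            ring_nf
          rw [this]
          nth_rewrite 1 [hh]
          rw [Finset.sum_mul]
          refine Finset.sum_congr rfl fun Q _ => ?_
          by_cases hx : x ∈ Q.carrier <;> simp [hx]
      _ = _ := by
          rw [lintegral_finsetSum _ fun Q _ => (hhpm.const_mul _).indicator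
            Q.measurableSet_carrier]
          refine Finset.sum_congr rfl fun Q _ => ?_
          rw [lintegral_indicator Q.measurableSet_carrier, lintegral_const_mul _ hhpm]
  set I := ∫⁻ x, h x ^ s ∂weightMeasure ω with hIdef
  have hIfin : I ≠ ∞ := by
    rw [hI]
    exact ENNReal.sum_ne_top.2 fun Q _ => ENNReal.mul_ne_top (hcfin Q) (hhfin Q)
  set G : Cube n → ℝ≥0∞ := fun Q =>
    (wMass ω Q)⁻¹ * ∫⁻ x in Q.carrier, h x ^ (s - 1) ∂weightMeasure ω with hG
  set f : Cube n → ℝ≥0∞ := fun Q =>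
    (wMass σ' Q)⁻¹ * ∫⁻ y in Q.carrier, g y ∂weightMeasure σ' with hf
  have hGmul : ∀ Q, ∫⁻ x in Q.carrier, h x ^ (s - 1) ∂weightMeasure ω = wMass ω Q * G Q := by
    intro Q
    rcases eq_or_ne (wMass ω Q) 0 with h0 | h0
    · have : (weightMeasure ω).restrict Q.carrier = 0 := by
        rw [Measure.restrict_eq_zero, weightMeasure_carrier, h0]
      simp [this, h0]
    · rw [hG, ← mul_assoc, ENNReal.mul_inv_cancel h0 (hω.wMass_ne_top Q), one_mul]
  have hcarlω := carleson_embedding_weight hn hSd hη hS hω hF hhpm (fun Q _ => hhfin Q) hq1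
  have hcarlσ := carleson_embedding_weight hn hSd hη hS hσ hF hg (fun Q _ => hgfin Q) hp
  have hsq : ∀ x, (h x ^ (s - 1)) ^ q = h x ^ s := by
    intro x
    rw [← ENNReal.rpow_mul]
    congr 1
    rw [hs, hq]
    field_simp
  simp only [hsq] at hcarlω
  have e1 : 1 / q = 1 - r / p := by rw [hq]; field_simp
  have e2 : 1 / s = r / p := by rw [hs]; field_simp
  have hbound : I ≤ twoWeightChar p p α S ω σ' ^ r *
      ((ENNReal.ofReal (q * 2 ^ q / (q - 1)) * ((ENNReal.ofReal η)⁻¹ * AinfChar ω) * I) ^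
          (1 - r / p) *
        (ENNReal.ofReal (p * 2 ^ p / (p - 1)) * ((ENNReal.ofReal η)⁻¹ * AinfChar σ') *
          ∫⁻ x, g x ^ p ∂weightMeasure σ') ^ (r / p)) := by
    calc I = ∑ Q ∈ F, c Q * wMass ω Q * G Q := by
          rw [hI]
          exact Finset.sum_congr rfl fun Q _ => by rw [hGmul, mul_assoc]
      _ ≤ ∑ Q ∈ F, twoWeightChar p p α S ω σ' ^ r * ((wMass ω Q ^ (1 - r / p) * G Q) *
            (wMass σ' Q ^ (r / p) * f Q ^ r)) := by
          refine Finset.sum_le_sum fun Q hQ => ?_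
          calc c Q * wMass ω Q * G Q
              ≤ twoWeightChar p p α S ω σ' ^ r * (wMass ω Q ^ (1 - r / p) *
                  (wMass σ' Q ^ (r / p) * f Q ^ r)) * G Q := by
                gcongr ?_ * G Q
                exact coeff_mul_wMass_le hp hr hω hσ (hF hQ) g
            _ = _ := by ring
      _ ≤ twoWeightChar p p α S ω σ' ^ r *
            ((∑ Q ∈ F, (wMass ω Q ^ (1 - r / p) * G Q) ^ q) ^ (1 / q) *
              (∑ Q ∈ F, (wMass σ' Q ^ (r / p) * f Q ^ r) ^ s) ^ (1 / s)) := by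
          rw [← Finset.mul_sum]
          gcongr
          exact ENNReal.inner_le_Lp_mul_Lq F _ _ hconj
      _ = twoWeightChar p p α S ω σ' ^ r *
            ((∑ Q ∈ F, wMass ω Q * G Q ^ q) ^ (1 - r / p) *
              (∑ Q ∈ F, wMass σ' Q * f Q ^ p) ^ (r / p)) := by
          rw [e1, e2]
          congr 4
          · funext Q
            rw [ENNReal.mul_rpow_of_nonneg _ _ (by linarith), ← ENNReal.rpow_mul, ← e1,
              one_div_mul_cancel (by linarith), ENNReal.rpow_one]
          · funext Q
            rw [ENNReal.mul_rpow_of_nonneg _ _ (by linarith), ← ENNReal.rpow_mul,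
              ← ENNReal.rpow_mul, ← e2, one_div_mul_cancel (by linarith), ENNReal.rpow_one,
              hs, mul_div_cancel₀ _ hr.ne']
      _ ≤ _ := by
          have : 0 ≤ 1 - r / p := by rw [← e1]; positivity
          gcongr
  rcases eq_or_ne I 0 with hI0 | hI0
  · rw [hI0, ENNReal.zero_rpow_of_pos (by positivity)]
    exact zero_le
  have h1t : 0 ≤ 1 - r / p := by rw [← e1]; positivity
  have hne0 : I ^ (1 - r / p) ≠ 0 := by simp [hI0, hIfin]
  have hnet : I ^ (1 - r / p) ≠ ∞ := ENNReal.rpow_ne_top_of_nonneg h1t hIfin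
  have hIsplit : I = I ^ (r / p) * I ^ (1 - r / p) := by
    rw [← ENNReal.rpow_add _ _ hI0 hIfin]
    simp
  rw [ENNReal.mul_rpow_of_nonneg _ I h1t] at hbound
  rw [← ENNReal.mul_le_mul_iff_left hne0 hnet, ← hIsplit]
  exact hbound.trans_eq (by ring)

theorem rpow_mul_rpow_le_add {a t : ℝ} (ha : 0 ≤ a) (ht0 : 0 ≤ t) (ht1 : t ≤ 1) (x y : ℝ≥0∞) :
    x ^ (a * (1 - t)) * y ^ (a * t) ≤
      x ^ (a * (1 - t) ^ 2) * y ^ (a * (1 - (1 - t) ^ 2)) +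
        x ^ (a * (1 - t ^ 2)) * y ^ (a * t ^ 2) := by
  set X := x ^ (a * (1 - t) ^ 2) * y ^ (a * (1 - (1 - t) ^ 2)) with hX
  set Y := x ^ (a * (1 - t ^ 2)) * y ^ (a * t ^ 2) with hY
  have h2 : (0 : ℝ) ≤ 1 / 2 := by norm_num
  have hu : 0 ≤ 1 - t := by linarith
  have hv : 0 ≤ 1 - t ^ 2 := by nlinarith
  have hw : 0 ≤ 1 - (1 - t) ^ 2 := by nlinarith
  have hXY : x ^ (a * (1 - t)) * y ^ (a * t) = X ^ (1 / 2 : ℝ) * Y ^ (1 / 2 : ℝ) := by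
    rw [hX, hY, ENNReal.mul_rpow_of_nonneg _ _ h2, ENNReal.mul_rpow_of_nonneg _ _ h2,
      mul_mul_mul_comm]
    simp only [← ENNReal.rpow_mul]
    rw [← ENNReal.rpow_add_of_nonneg _ _ (by positivity) (by positivity),
      ← ENNReal.rpow_add_of_nonneg _ _ (by positivity) (by positivity)]
    congr 2 <;> ring
  rw [hXY]
  calc X ^ (1 / 2 : ℝ) * Y ^ (1 / 2 : ℝ)
      ≤ (X + Y) ^ (1 / 2 : ℝ) * (X + Y) ^ (1 / 2 : ℝ) := by
        gcongr
        · exact le_self_add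
        · exact le_add_self
    _ = X + Y := by
        rw [← ENNReal.rpow_add_of_nonneg _ _ h2 h2, add_halves, ENNReal.rpow_one]

/-- Monotone convergence for sums over countable families of cubes. -/
theorem lintegral_cubeSum_rpow_le (hScount : S.Countable) {s : ℝ} (hs : 0 < s)
    {c : Cube n → ℝ≥0∞} {μ : Measure (Fin n → ℝ)} {b : ℝ≥0∞}
    (hb : ∀ F : Finset (Cube n), (F : Set (Cube n)) ⊆ S →
      ∫⁻ x, (∑ Q ∈ F, Q.carrier.indicator (fun _ => c Q) x) ^ s ∂μ ≤ b) :
    ∫⁻ x, cubeSum S c x ^ s ∂μ ≤ b := by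
  classical
  have := hScount.to_subtype
  have hsup : ∀ x, cubeSum S c x ^ s =
      ⨆ F : Finset S, (∑ Q ∈ F, Q.1.carrier.indicator (fun _ => c Q.1) x) ^ s := by
    intro x
    rw [cubeSum, ENNReal.tsum_eq_iSup_sum]
    exact (ENNReal.orderIsoRpow s hs).map_iSup _
  simp only [hsup]
  rw [lintegral_iSup_directed]
  · refine iSup_le fun F => ?_
    have h := hb (F.map (Function.Embedding.subtype _)) (by
      intro Q hQ
      obtain ⟨T, _, rfl⟩ := Finset.mem_map.1 hQ
      exact T.2)
    simpa only [Finset.sum_map, Function.Embedding.subtype_apply] using h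
  · exact fun F => ((Finset.measurable_sum _ fun Q _ =>
      measurable_const.indicator Q.1.measurableSet_carrier).pow_const _).aemeasurable
  · refine Monotone.directed_le fun F F' hFF' x => ?_
    exact ENNReal.rpow_le_rpow (Finset.sum_le_sum_of_subset hFF') hs.le

end Sparse

/-- the main two-weight `A_{pq}`–`A∞` estimate for sparse operators in the
exceptional diagonal case `p = q > r`, `α < 1`. -/
theorem stmt2 (n : ℕ) (hn : 1 ≤ n) (p r α η : ℝ)
    (hp : 1 < p) (hr : 0 < r) (hrp : r < p) (hα : 0 < α) (hα1 : α < 1)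
    (hη : 0 < η) (hη1 : η ≤ 1) :
    ∃ C : ℝ, 0 < C ∧
      ∀ (S : Set (Cube n)), (∀ Q ∈ S, Q.IsDyadic) → IsSparse η S →
      ∀ ω σ' : (Fin n → ℝ) → ℝ, IsWeight ω → IsWeight σ' →
        AinfChar ω < ∞ → AinfChar σ' < ∞ → twoWeightChar p p α S ω σ' < ∞ →
        ∀ f : (Fin n → ℝ) → ℝ, Measurable f → wNorm p σ' f < ∞ →
          eNorm p ω (sparseOp S r α (fun y => f y * σ' y)) ≤
            ENNReal.ofReal C * twoWeightChar p p α S ω σ' *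
              (AinfChar ω ^ ((1 / r) * (1 - r / p) ^ 2) *
                  AinfChar σ' ^ ((1 / r) * (1 - (1 - r / p) ^ 2)) +
                AinfChar ω ^ ((1 / r) * (1 - (r / p) ^ 2)) *
                  AinfChar σ' ^ ((1 / r) * (r / p) ^ 2)) *
              wNorm p σ' f := by
  have hp0 : 0 < p := by linarith
  have hpr : 0 < p - r := by linarith
  set t := r / p with ht
  have ht0 : 0 ≤ t := by positivity
  have ht1 : t ≤ 1 := (div_le_one hp0).2 hrp.le
  have hr1 : 0 ≤ 1 / r := by positivity
  have h1t : 0 ≤ 1 - t := by linarith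
  set c₁ : ℝ≥0∞ := ENNReal.ofReal (p / (p - r) * 2 ^ (p / (p - r)) / (p / (p - r) - 1)) with hc₁
  set c₂ : ℝ≥0∞ := ENNReal.ofReal (p * 2 ^ p / (p - 1)) with hc₂
  set e : ℝ≥0∞ := (ENNReal.ofReal η)⁻¹ with he
  set C₀ : ℝ≥0∞ := (c₁ * e) ^ (1 / r * (1 - t)) * (c₂ * e) ^ (1 / r * t) with hC₀
  have hefin : e ≠ ∞ := ENNReal.inv_ne_top.2 (by simpa using hη)
  have hC₀fin : C₀ ≠ ∞ :=
    ENNReal.mul_ne_top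
      (ENNReal.rpow_ne_top_of_nonneg (by positivity)
        (ENNReal.mul_ne_top ENNReal.ofReal_ne_top hefin))
      (ENNReal.rpow_ne_top_of_nonneg (by positivity)
        (ENNReal.mul_ne_top ENNReal.ofReal_ne_top hefin))
  refine ⟨C₀.toReal + 1, by positivity, ?_⟩
  intro S hSd hS ω σ' hω hσ _ _ _ f hf hffin
  have hC : C₀ ≤ ENNReal.ofReal (C₀.toReal + 1) :=
    (ENNReal.ofReal_toReal hC₀fin).ge.trans (ENNReal.ofReal_le_ofReal (by linarith))
  set g : (Fin n → ℝ) → ℝ≥0∞ := fun x => ENNReal.ofReal |f x| with hg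
  have hgm : Measurable g := by fun_prop
  set N := ∫⁻ x, g x ^ p ∂weightMeasure σ' with hN
  have hNf : wNorm p σ' f = N ^ (1 / p) := by
    rw [wNorm, hN, hσ.lintegral_weightMeasure (hgm.pow_const p)]
    simp only [hg, ENNReal.ofReal_rpow_of_nonneg (abs_nonneg _) hp0.le]
  have hNfin : N ≠ ∞ := by
    intro h
    rw [hNf, h, ENNReal.top_rpow_of_pos (by positivity)] at hffin
    exact hffin.ne rfl
  set c : Cube n → ℝ≥0∞ := fun Q =>
    (ENNReal.ofReal Q.vol ^ (-α) * ∫⁻ y in Q.carrier, g y ∂weightMeasure σ') ^ r with hc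
  have hcube : ∀ x, cubeSum S (fun Q => (ENNReal.ofReal Q.vol ^ (-α) *
      ∫⁻ y in Q.carrier, ENNReal.ofReal (f y * σ' y)) ^ r) x ≤ cubeSum S c x := by
    intro x
    refine ENNReal.tsum_le_tsum fun Q => indicator_le_indicator ?_
    refine ENNReal.rpow_le_rpow (mul_le_mul_right ?_ _) hr.le
    rw [hσ.setLIntegral_weightMeasure hgm]
    refine lintegral_mono fun y => ?_
    rw [hg, ← ENNReal.ofReal_mul (abs_nonneg _)]
    exact ENNReal.ofReal_le_ofReal (mul_le_mul_of_nonneg_right (le_abs_self _) (hσ.2 y))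
  have hcm : Measurable (cubeSum S c) := by
    have := (Cube.countable_of_isDyadic hSd).to_subtype
    exact Measurable.tsum fun Q =>
      measurable_const.indicator Q.1.measurableSet_carrier
  set A := twoWeightChar p p α S ω σ'
  set D : ℝ≥0∞ := A ^ r * ((c₁ * (e * AinfChar ω)) ^ (1 - t) *
    (c₂ * (e * AinfChar σ') * N) ^ t) with hD
  have hmain : ∫⁻ x, cubeSum S c x ^ (p / r) ∂weightMeasure ω ≤ D ^ (p / r) := by
    refine lintegral_cubeSum_rpow_le (Cube.countable_of_isDyadic hSd) (by positivity)
      fun F hF => ?_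
    rw [← inv_div, ENNReal.le_rpow_inv_iff (by positivity)]
    simpa only [inv_div] using
      lintegral_finset_sum_le hn hp hr hrp hη hSd hS hω hσ hgm hNfin hF
  have hLHS : eNorm p ω (sparseOp S r α (fun y => f y * σ' y)) ≤ D ^ (1 / r) := by
    calc eNorm p ω (sparseOp S r α (fun y => f y * σ' y))
        ≤ (∫⁻ x, cubeSum S c x ^ (p / r) ∂weightMeasure ω) ^ (1 / p) := by
          rw [hω.lintegral_weightMeasure (hcm.pow_const _), eNorm]
          gcongr with x
          rw [sparseOp, ← ENNReal.rpow_mul, one_div_mul_eq_div]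
          gcongr
          exact hcube x
      _ ≤ (D ^ (p / r)) ^ (1 / p) := by gcongr
      _ = D ^ (1 / r) := by
          rw [← ENNReal.rpow_mul]
          congr 1
          field_simp
  have hDeq : D ^ (1 / r) = C₀ * A *
      (AinfChar ω ^ (1 / r * (1 - t)) * AinfChar σ' ^ (1 / r * t)) * N ^ (1 / p) := by
    have e1 : r * (1 / r) = 1 := by field_simp
    have e2 : t * (1 / r) = 1 / p := by rw [ht]; field_simp
    rw [hD, hC₀, ← mul_assoc c₁, ← mul_assoc c₂,
      ENNReal.mul_rpow_of_nonneg _ _ hr1, ENNReal.mul_rpow_of_nonneg _ _ hr1,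
      ← ENNReal.rpow_mul, ← ENNReal.rpow_mul, ← ENNReal.rpow_mul, e1, ENNReal.rpow_one,
      ENNReal.mul_rpow_of_nonneg (c₂ * e * AinfChar σ') N (by positivity),
      ENNReal.mul_rpow_of_nonneg (c₂ * e) _ (by positivity),
      ENNReal.mul_rpow_of_nonneg (c₁ * e) _ (by positivity), mul_comm (1 - t) (1 / r), e2,
      mul_comm (1 / r) t, e2]
    ring
  calc eNorm p ω (sparseOp S r α (fun y => f y * σ' y)) ≤ D ^ (1 / r) := hLHS
    _ = _ := hDeq
    _ ≤ _ := by
        rw [hNf]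
        gcongr
        exact rpow_mul_rpow_le_add hr1 ht0 ht1 _ _
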